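/- arXiv:1110.2956 — 3 statements merged into one kernel-verified Lean document; each statement's English description precedes it below -/
import Mathlib

section
/- Let R be a commutative ring and P a finitely generated projective R-module. The following are equivalent: (1) P is a generator of the category of R-modules; (2) the rank function of P on Spec(R) is everywhere positive, i.e. for every prime ideal 𝔭 of R the rank of the free R_𝔭-module P_𝔭 is positive; (3) there exists a finitely generated projective R-module Q and a positive integer n such that P ⊗_R Q is isomorphic as an R-module to R^n. -/
universe u
open TensorProduct CategoryTheory

/-- For integers `0 < r ≤ t < M`, some polynomial `a + (M - x) ^ M` with `a ≥ 0`, when multiplied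
by `x`, becomes constant modulo `(x - r) * (x - t)`. -/
lemma exists_mul_sub_dvd {K : Type*} [CommRing K] (x : K) {r t M : ℕ} (hr : 0 < r) (hrt : r ≤ t)
    (ht : t < M) : ∃ a : ℕ, (x - r) * (x - t) ∣
      x * (a + (M - x) ^ M) - ((r * (a + (M - r) ^ M) : ℕ) : K) := by
  set σ : ℕ := ∑ i ∈ Finset.range M, (M - t) ^ i * (M - r) ^ (M - 1 - i) with hσ
  have hle : (M - t) ^ M ≤ r * σ := by
    have h1 : M * (M - t) ^ (M - 1) ≤ σ := by
      have : ∀ i ∈ Finset.range M,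
          (M - t) ^ (M - 1) ≤ (M - t) ^ i * (M - r) ^ (M - 1 - i) := by
        intro i hi
        have hi' := Finset.mem_range.1 hi
        calc (M - t) ^ (M - 1) = (M - t) ^ i * (M - t) ^ (M - 1 - i) := by
              rw [← pow_add]; congr 1; omega
          _ ≤ _ := by gcongr
      simpa using Finset.card_nsmul_le_sum _ _ _ this
    calc (M - t) ^ M = (M - t) * (M - t) ^ (M - 1) := by
          rw [← pow_succ']; congr 1; omega
      _ ≤ M * (M - t) ^ (M - 1) := by gcongr; omega
      _ ≤ σ := h1
      _ ≤ r * σ := Nat.le_mul_of_pos_left _ hr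
  refine ⟨r * σ - (M - t) ^ M, ?_⟩
  let h : Polynomial K := (M - .X) ^ M - r * ∑ i ∈ Finset.range M,
    (M - .X) ^ i * ((M - r : Polynomial K)) ^ (M - 1 - i)
  have key := Polynomial.sub_dvd_eval_sub x (t : K) h
  simp only [h, Polynomial.eval_sub, Polynomial.eval_mul, Polynomial.eval_pow,
    Polynomial.eval_natCast, Polynomial.eval_X, Polynomial.eval_finsetSum] at key
  have hg := geom_sum₂_mul (M - x : K) (M - r) M
  convert mul_dvd_mul_left (x - (r : K)) key using 1
  rw [hσ] at *
  push_cast [Nat.cast_sub hle, Nat.cast_sub ht.le, Nat.cast_sub (hrt.trans ht.le)]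
  linear_combination -(r : K) * hg

lemma sub_prod_dvd {K : Type*} [CommRing K] (x : K) (a M N : ℕ) (l : List ℕ)
    (hl : ∀ r ∈ l, r < M) :
    (l.map fun r : ℕ ↦ x - (r : K)).prod ∣
      ((l.map fun r : ℕ ↦ r * (a + (M - r) ^ N)).map
        fun r : ℕ ↦ x * (a + (M - x) ^ N) - (r : K)).prod := by
  induction l with
  | nil => simp
  | cons r l ih =>
    simp only [List.map_cons, List.prod_cons]
    refine mul_dvd_mul ?_ (ih fun s hs ↦ hl s (by simp [hs]))
    have key := Polynomial.sub_dvd_eval_sub x (r : K) (.X * (a + (M - .X) ^ N))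
    simpa [Nat.cast_sub (hl r (by simp)).le] using key

/-- In a commutative ring with a subsemiring `E` of effective elements all of which are bounded by
integers, an effective root of a product of factors `X - r` with `r` a positive integer divides a
positive integer with effective quotient. -/
lemma exists_mul_eq_natCast {K : Type*} [CommRing K] (E : Subsemiring K)
    (hE : ∀ x ∈ E, ∃ N : ℕ, ∀ M ≥ N, (M : K) - x ∈ E) (n : ℕ) :
    ∀ (l : List ℕ) (x : K), l.length = n → x ∈ E → (∀ r ∈ l, 0 < r) →
      (l.map fun r : ℕ ↦ x - (r : K)).prod = 0 → ∃ y ∈ E, ∃ m : ℕ, 0 < m ∧ x * y = m := by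
  induction n with
  | zero =>
    intro l x hl _ _ h
    rw [List.length_eq_zero_iff.1 hl] at h
    have := subsingleton_of_zero_eq_one (M₀ := K) (by simpa using h.symm)
    exact ⟨1, one_mem _, 1, one_pos, Subsingleton.elim _ _⟩
  | succ n ih =>
    rintro (_ | ⟨r, _ | ⟨t, l⟩⟩) x hl hx hpos h
    · simp at hl
    · exact ⟨1, one_mem _, r, hpos r (by simp), by simpa [sub_eq_zero] using h⟩
    · wlog hrt : r ≤ t generalizing r t
      · refine this t r (by simpa using hl) (fun s hs ↦ hpos s ?_) ?_ (by omega)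
        · simp only [List.mem_cons] at hs ⊢; tauto
        · simpa [mul_left_comm] using h
      obtain ⟨N, hN⟩ := hE x hx
      set M := N + (r :: t :: l).sum + 1 with hM
      have hlt : ∀ s ∈ r :: t :: l, s < M := fun s hs ↦ by
        have := List.single_le_sum (fun _ _ ↦ Nat.zero_le _) s hs
        omega
      obtain ⟨a, ha⟩ := exists_mul_sub_dvd x (hpos r (by simp)) hrt (hlt t (by simp))
      have hw : (a + (M - x) ^ M : K) ∈ E :=
        add_mem (natCast_mem E a) (pow_mem (hN M (by omega)) M)
      have hposw : ∀ s ∈ r :: t :: l, 0 < s * (a + (M - s) ^ M) := fun s hs ↦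
        mul_pos (hpos s hs) (Nat.add_pos_right _ (pow_pos (Nat.sub_pos_of_lt (hlt s hs)) _))
      obtain ⟨y, hy, m, hm, hxy⟩ := ih
        (r * (a + (M - r) ^ M) :: l.map fun s ↦ s * (a + (M - s) ^ M))
        (x * (a + (M - x) ^ M)) (by simpa using hl) (mul_mem hx hw)
        (by
          intro s hs
          rcases List.mem_cons.1 hs with rfl | hs
          · exact hposw r (by simp)
          · obtain ⟨s', hs', rfl⟩ := List.mem_map.1 hs
            exact hposw s' (by simp [hs']))
        (by
          refine zero_dvd_iff.1 ?_
          rw [← h]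
          simp only [List.map_cons, List.prod_cons, ← mul_assoc]
          exact mul_dvd_mul ha (sub_prod_dvd x a M M l fun s hs ↦ hlt s (by simp [hs])))
      exact ⟨_, mul_mem hw hy, m, hm, by rw [← mul_assoc, hxy]⟩

/-- In a commutative semiring, a stably constant element some multiple of which is bounded below
by `1` has a constant multiple. -/
lemma exists_natCast_mul_eq {S : Type*} [CommSemiring S] {x y : S} {a n k : ℕ} (hn : 0 < n)
    (hx : x + a = n + a) (hk : k * x = 1 + y) :
    ∃ j : ℕ, 0 < j ∧ (j : S) * x = (j * n : ℕ) := by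
  wlog ha : 0 < a generalizing a
  · exact this (a := a + 1) (by push_cast; rw [← add_assoc, hx, add_assoc]) (by omega)
  have hka : ((a * k : ℕ) : S) * x = a + a * y := by push_cast; rw [mul_assoc, hk]; ring
  have step : ∀ j : ℕ, ((a * k : ℕ) : S) * x + j * x = ((a * k : ℕ) : S) * x + j * n := by
    intro j
    induction j with
    | zero => simp
    | succ j ih =>
      calc ((a * k : ℕ) : S) * x + (j + 1 : ℕ) * x = (((a * k : ℕ) : S) * x + j * x) + x := by
            push_cast; ring
        _ = a * y + j * n + (x + a) := by rw [ih, hka]; ring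
        _ = ((a * k : ℕ) : S) * x + (j + 1 : ℕ) * n := by rw [hx, hka]; push_cast; ring
  have many : ∀ j : ℕ, (j : S) * x + a = j * n + a := by
    intro j
    induction j with
    | zero => simp
    | succ j ih =>
      calc ((j + 1 : ℕ) : S) * x + a = (j * x + a) + x := by push_cast; ring
        _ = j * n + (x + a) := by rw [ih]; ring
        _ = _ := by rw [hx]; push_cast; ring
  obtain ⟨b, hb⟩ : ∃ b, a * n = a + b := Nat.exists_eq_add_of_le (Nat.le_mul_of_pos_right a hn)
  refine ⟨a * k + a, by omega, ?_⟩
  calc ((a * k + a : ℕ) : S) * x = ((a * k : ℕ) : S) * x + a * x := by push_cast; ring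
    _ = (((a * k : ℕ) : S) * x + a) + b := by
      rw [step, ← Nat.cast_mul a n, hb]; push_cast; ring
    _ = (a * k : ℕ) * n + (a * n : ℕ) := by rw [many, hb]; push_cast; ring
    _ = _ := by push_cast; ring

/-- A finitely generated projective module. -/
structure FinProj (R : Type u) [CommRing R] where
  /-- The underlying module. -/
  carrier : Type u
  [addCommGroup : AddCommGroup carrier]
  [module : Module R carrier]
  [finite : Module.Finite R carrier]
  [projective : Module.Projective R carrier]

namespace FinProj

attribute [instance] addCommGroup module finite projective

variable (R : Type u) [CommRing R]

instance : CoeSort (FinProj R) (Type u) := ⟨carrier⟩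

/-- Finitely generated projective modules up to isomorphism. -/
instance setoid : Setoid (FinProj R) where
  r A B := Nonempty (A ≃ₗ[R] B)
  iseqv := ⟨fun _ ↦ ⟨.refl _ _⟩, fun ⟨e⟩ ↦ ⟨e.symm⟩, fun ⟨e⟩ ⟨f⟩ ↦ ⟨e.trans f⟩⟩

/-- The isomorphism classes of finitely generated projective modules. -/
abbrev Class : Type (u + 1) := Quotient (setoid R)

variable {R} in
/-- The isomorphism class of a finitely generated projective module. -/
def cls (A : FinProj R) : Class R := ⟦A⟧

variable {R} in
lemma cls_eq_cls_iff {A B : FinProj R} : A.cls = B.cls ↔ Nonempty (A ≃ₗ[R] B) := Quotient.eq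

instance : Add (Class R) :=
  ⟨Quotient.map₂ (fun A B ↦ ⟨A × B⟩) fun _ _ ⟨e⟩ _ _ ⟨f⟩ ↦ ⟨e.prodCongr f⟩⟩

instance : Mul (Class R) :=
  ⟨Quotient.map₂ (fun A B ↦ ⟨A ⊗[R] B⟩) fun _ _ ⟨e⟩ _ _ ⟨f⟩ ↦ ⟨TensorProduct.congr e f⟩⟩

instance : Zero (Class R) := ⟨cls ⟨PUnit⟩⟩

instance : One (Class R) := ⟨cls ⟨R⟩⟩

/-- Isomorphism classes of finitely generated projective modules form a commutative semiring
under direct sum and tensor product. -/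
instance : CommSemiring (Class R) where
  nsmul := nsmulRec
  add_assoc := by
    rintro ⟨A⟩ ⟨B⟩ ⟨C⟩
    exact Quotient.sound ⟨LinearEquiv.prodAssoc R A B C⟩
  zero_add := by
    rintro ⟨A⟩
    exact Quotient.sound ⟨LinearEquiv.uniqueProd⟩
  add_zero := by
    rintro ⟨A⟩
    exact Quotient.sound ⟨LinearEquiv.prodUnique⟩
  add_comm := by
    rintro ⟨A⟩ ⟨B⟩
    exact Quotient.sound ⟨LinearEquiv.prodComm R A B⟩
  mul_assoc := by
    rintro ⟨A⟩ ⟨B⟩ ⟨C⟩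
    exact Quotient.sound ⟨TensorProduct.assoc R A B C⟩
  one_mul := by
    rintro ⟨A⟩
    exact Quotient.sound ⟨TensorProduct.lid R A⟩
  mul_one := by
    rintro ⟨A⟩
    exact Quotient.sound ⟨TensorProduct.rid R A⟩
  mul_comm := by
    rintro ⟨A⟩ ⟨B⟩
    exact Quotient.sound ⟨TensorProduct.comm R A B⟩
  left_distrib := by
    rintro ⟨A⟩ ⟨B⟩ ⟨C⟩
    exact Quotient.sound ⟨TensorProduct.prodRight R R A B C⟩
  right_distrib := by
    rintro ⟨A⟩ ⟨B⟩ ⟨C⟩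
    exact Quotient.sound ⟨TensorProduct.prodLeft R R A B C⟩
  zero_mul := by
    rintro ⟨A⟩
    exact Quotient.sound ⟨LinearEquiv.ofSubsingleton (PUnit.{u + 1} ⊗[R] A) PUnit.{u + 1}⟩
  mul_zero := by
    rintro ⟨A⟩
    exact Quotient.sound ⟨LinearEquiv.ofSubsingleton (A ⊗[R] PUnit.{u + 1}) PUnit.{u + 1}⟩

variable {R}

instance (A : FinProj R) (n : ℕ) : Module.Projective R (Fin n → A) :=
  .of_equiv (DFinsupp.linearEquivFunOnFintype (R := R) (M := fun _ : Fin n ↦ (A : Type u)))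

lemma cls_prod (A B : FinProj R) : cls ⟨A × B⟩ = A.cls + B.cls := rfl

lemma cls_tensor (A B : FinProj R) : cls ⟨A ⊗[R] B⟩ = A.cls * B.cls := rfl

lemma cls_pi (A : FinProj R) (n : ℕ) : cls ⟨Fin n → A⟩ = (n : Class R) * A.cls := by
  induction n with
  | zero =>
    rw [Nat.cast_zero, zero_mul]
    exact Quotient.sound ⟨LinearEquiv.ofSubsingleton (Fin 0 → A) PUnit.{u + 1}⟩
  | succ n ih =>
    rw [Nat.cast_succ, add_mul, one_mul, add_comm (_ * _) A.cls, ← ih, ← cls_prod]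
    exact Quotient.sound ⟨(Fin.consLinearEquiv R fun _ : Fin (n + 1) ↦ (A : Type u)).symm⟩

lemma cls_free (n : ℕ) : cls (⟨Fin n → R⟩ : FinProj R) = n := by
  have := cls_pi (⟨R⟩ : FinProj R) n
  exact this.trans (mul_one _)

lemma exists_cls_add_of_surjective {A B : FinProj R} (g : A →ₗ[R] B)
    (hg : Function.Surjective g) : ∃ C : FinProj R, A.cls = B.cls + C.cls := by
  obtain ⟨f, hf⟩ := Module.projective_lifting_property g .id hg
  let e : (LinearMap.ker g × B) ≃ₗ[R] A := lequivProdOfRightSplitExact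
    (LinearMap.ker g).subtype_injective (Submodule.range_subtype _) hf
  have : Module.Projective R (LinearMap.ker g) :=
    .of_split (e.toLinearMap ∘ₗ .inl R _ _) (.fst R _ _ ∘ₗ e.symm.toLinearMap) (by ext; simp)
  have : Module.Finite R (LinearMap.ker g) :=
    .of_surjective (.fst R _ B ∘ₗ e.symm.toLinearMap)
      (Prod.fst_surjective.comp e.symm.surjective)
  refine ⟨⟨LinearMap.ker g⟩, ?_⟩
  rw [add_comm, ← cls_prod]
  exact Quotient.sound ⟨e.symm⟩

lemma exists_cls_add_eq_natCast (A : FinProj R) :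
    ∃ (N : ℕ) (C : FinProj R), A.cls + C.cls = N := by
  obtain ⟨N, g, hg⟩ := Module.Finite.exists_fin' R A
  obtain ⟨C, hC⟩ := exists_cls_add_of_surjective (A := ⟨Fin N → R⟩) g hg
  exact ⟨N, C, by rw [← hC, cls_free]⟩

/-- Two modules are equivalent up to `f` if there are maps in both directions
whose composites are multiplication by `f`. -/
def EquivUpTo (f : R) (A B : FinProj R) : Prop :=
  ∃ (φ : A →ₗ[R] B) (ψ : B →ₗ[R] A), ψ ∘ₗ φ = f • .id ∧ φ ∘ₗ ψ = f • .id

namespace EquivUpTo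

lemma smul {f : R} {A B : FinProj R} (h : EquivUpTo f A B) (a : R) : EquivUpTo (a * f) A B := by
  obtain ⟨φ, ψ, h₁, h₂⟩ := h
  exact ⟨a • φ, ψ, by rw [LinearMap.comp_smul, h₁, smul_smul],
    by rw [LinearMap.smul_comp, h₂, smul_smul]⟩

lemma cls_eq {A B : FinProj R} (h : EquivUpTo (1 : R) A B) : A.cls = B.cls := by
  obtain ⟨φ, ψ, h₁, h₂⟩ := h
  exact Quotient.sound ⟨.ofLinearMap φ ψ (by simpa using h₂) (by simpa using h₁)⟩

/-- The tensor product of two `2`-periodic complexes on which `f` and `g` are null-homotopic;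
there `f + g` is null-homotopic. -/
lemma tensor {f g : R} {A B C D : FinProj R} (h : EquivUpTo f A B) (h' : EquivUpTo g C D) :
    EquivUpTo (f + g) ⟨(A ⊗[R] C) × (B ⊗[R] D)⟩ ⟨(A ⊗[R] D) × (B ⊗[R] C)⟩ := by
  obtain ⟨φ, ψ, h₁, h₂⟩ := h
  obtain ⟨φ', ψ', h₁', h₂'⟩ := h'
  replace h₁ := LinearMap.congr_fun h₁
  replace h₂ := LinearMap.congr_fun h₂
  replace h₁' := LinearMap.congr_fun h₁'
  replace h₂' := LinearMap.congr_fun h₂'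
  simp only [LinearMap.comp_apply, LinearMap.smul_apply, LinearMap.id_apply] at h₁ h₂ h₁' h₂'
  refine ⟨((φ'.lTensor A).coprod (ψ.rTensor D)).prod ((φ.rTensor C).coprod (-ψ'.lTensor B)),
    ((ψ'.lTensor A).coprod (ψ.rTensor C)).prod ((φ.rTensor D).coprod (-φ'.lTensor B)), ?_, ?_⟩
  all_goals
    refine LinearMap.prod_ext (TensorProduct.ext' fun x y ↦ ?_) (TensorProduct.ext' fun x y ↦ ?_)
    all_goals
      simp [h₁, h₂, h₁', h₂', ← TensorProduct.smul_tmul', add_smul, add_comm (g • (_ : _ ⊗[R] _))]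

end EquivUpTo

/-- The Grothendieck ring of finitely generated projective modules. -/
abbrev K₀ (R : Type u) [CommRing R] : Type (u + 1) := ℤ ⊗[ℕ] Class R

/-- The class in the Grothendieck ring. -/
noncomputable abbrev toK₀ : Class R →+* K₀ R :=
  (Algebra.TensorProduct.includeRight : Class R →ₐ[ℕ] ℤ ⊗[ℕ] Class R).toRingHom

lemma exists_add_natCast_eq {x y : Class R} (h : toK₀ x = toK₀ y) :
    ∃ a : ℕ, x + a = y + a := by
  let f : ℤ →ₗ[ℕ] Class R →ₗ[ℕ] Algebra.GrothendieckAddGroup (Class R) :=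
    LinearMap.mk₂ ℕ (fun z s ↦ z • Algebra.GrothendieckAddGroup.of s)
      (fun _ _ _ ↦ add_smul _ _ _) (fun c m n ↦ by simp [mul_smul])
      (fun _ _ _ ↦ by simp) (fun c m n ↦ by rw [map_nsmul, smul_comm])
  have h' := congrArg (TensorProduct.lift f) h
  simp only [toK₀, f, AlgHom.toRingHom_eq_coe, RingHom.coe_coe,
    Algebra.TensorProduct.includeRight_apply, TensorProduct.lift.tmul, LinearMap.mk₂_apply,
    one_smul] at h'
  obtain ⟨⟨c, _⟩, hc⟩ := (AddSubmonoid.LocalizationMap.eq_iff_exists _).1 h'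
  induction c using Quotient.inductionOn with | _ C
  obtain ⟨N, D, hD⟩ := exists_cls_add_eq_natCast C
  refine ⟨N, ?_⟩
  rw [← hD, ← add_assoc, ← add_assoc, add_comm x, add_comm y]
  exact congrArg (· + _) hc

lemma EquivUpTo.exists_of_isLocalizedModule (S : Submonoid R) {A B : FinProj R}
    {A' B' : Type*} [AddCommGroup A'] [Module R A'] [AddCommGroup B'] [Module R B']
    (f : A →ₗ[R] A') (g : B →ₗ[R] B') [IsLocalizedModule S f] [IsLocalizedModule S g]
    (e : A' ≃ₗ[R] B') : ∃ s ∈ S, EquivUpTo s A B := by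
  have := Module.finitePresentation_of_projective R A
  have := Module.finitePresentation_of_projective R B
  obtain ⟨φ, s, hφ⟩ :=
    Module.FinitePresentation.exists_lift_of_isLocalizedModule S g (e.toLinearMap ∘ₗ f)
  obtain ⟨ψ, t, hψ⟩ :=
    Module.FinitePresentation.exists_lift_of_isLocalizedModule S f (e.symm.toLinearMap ∘ₗ g)
  replace hφ := LinearMap.congr_fun hφ
  replace hψ := LinearMap.congr_fun hψ
  simp only [LinearMap.comp_apply, LinearMap.smul_apply, LinearEquiv.coe_coe,
    Submonoid.smul_def] at hφ hψ
  obtain ⟨u, hu⟩ := Module.Finite.exists_smul_of_comp_eq_of_isLocalizedModule S f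
    (ψ ∘ₗ φ) ((s * t : R) • .id) (by ext x; simp [hφ, hψ, mul_smul, smul_comm (s : R)])
  obtain ⟨v, hv⟩ := Module.Finite.exists_smul_of_comp_eq_of_isLocalizedModule S g
    (φ ∘ₗ ψ) ((s * t : R) • .id) (by ext x; simp [hφ, hψ, mul_smul])
  simp only [Submonoid.smul_def] at hu hv
  refine ⟨u * v * (s * t), (u * v * (s * t)).2, φ, (u * v : R) • ψ, ?_, ?_⟩
  · rw [LinearMap.smul_comp, mul_comm (u : R), mul_smul, hu, smul_smul, smul_smul]
  · rw [LinearMap.comp_smul, mul_smul, hv, smul_smul, smul_smul]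

/-- Locally, a projective module of positive rank is free of positive rank. -/
lemma exists_equivUpTo_free {A : FinProj R} (hA : ∀ p, 0 < Module.rankAtStalk (R := R) A p) :
    Ideal.span {f | ∃ r, 0 < r ∧ EquivUpTo f A ⟨Fin r → R⟩} = ⊤ := by
  by_contra h
  obtain ⟨m, hm, hle⟩ := Ideal.exists_le_maximal _ h
  let S := m.primeCompl
  have : Module.Free (Localization.AtPrime m) (LocalizedModule m.primeCompl A) :=
    Module.free_of_flat_of_isLocalRing
  let b := Module.finBasisOfFinrankEq (Localization.AtPrime m) (LocalizedModule S A)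
    (n := Module.rankAtStalk (R := R) A ⟨m, hm.isPrime⟩) rfl
  obtain ⟨s, hs, hs'⟩ := EquivUpTo.exists_of_isLocalizedModule (A := A)
    (B := ⟨Fin (Module.rankAtStalk (R := R) A ⟨m, hm.isPrime⟩) → R⟩) S
    (LocalizedModule.mkLinearMap S A)
    (.pi fun i ↦ Algebra.linearMap R (Localization.AtPrime m) ∘ₗ .proj i)
    (b.equivFun.restrictScalars R)
  exact hs (hle (Ideal.subset_span ⟨_, hA _, hs'⟩))

/-- The trace ideal of a projective module of positive rank is the unit ideal. -/
lemma span_range_dual_eq_top {A : FinProj R}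
    (hA : ∀ p, 0 < Module.rankAtStalk (R := R) A p) :
    Ideal.span (Set.range fun y : Module.Dual R A × A ↦ y.1 y.2) = ⊤ := by
  rw [eq_top_iff, ← exists_equivUpTo_free hA, Ideal.span_le]
  rintro f ⟨r, hr, φ, ψ, -, h⟩
  let i : Fin r := ⟨0, hr⟩
  refine Ideal.subset_span ⟨(LinearMap.proj i ∘ₗ φ, ψ (Pi.single i 1)), ?_⟩
  simpa using congrFun (LinearMap.congr_fun h (Pi.single i 1)) i

lemma exists_natCast_mul_cls_eq {A : FinProj R}
    (hA : ∀ p, 0 < Module.rankAtStalk (R := R) A p) :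
    ∃ (k : ℕ) (B : FinProj R), (k : Class R) * A.cls = 1 + B.cls := by
  have h1 : (1 : R) ∈ Ideal.span (Set.range fun y : Module.Dual R A × A ↦ y.1 y.2) := by
    simp [span_range_dual_eq_top hA]
  obtain ⟨k, c, y, h⟩ := Submodule.mem_span_set'.1 h1
  choose z hz using fun i ↦ (y i).2
  let g : (Fin k → A) →ₗ[R] R := ∑ i, c i • (z i).1 ∘ₗ .proj i
  have hg : g (fun i ↦ (z i).2) = 1 := by
    rw [← h]
    simp [g, ← hz]
  obtain ⟨C, hC⟩ := exists_cls_add_of_surjective (A := ⟨Fin k → A⟩) (B := ⟨R⟩) g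
    fun a ↦ ⟨a • fun i ↦ (z i).2, by rw [map_smul, hg, smul_eq_mul, mul_one]⟩
  exact ⟨k, C, by rw [← cls_pi, hC]; rfl⟩

/-- A projective module of positive rank is, in the Grothendieck ring, a root of a product of
factors `X - r` with `r` a positive integer. -/
lemma exists_prod_sub_eq_zero {A : FinProj R}
    (hA : ∀ p, 0 < Module.rankAtStalk (R := R) A p) :
    ∃ l : List ℕ, (∀ r ∈ l, 0 < r) ∧ (l.map fun r : ℕ ↦ toK₀ A.cls - (r : K₀ R)).prod = 0 := by
  suffices H : ∀ f ∈ Ideal.span {f | ∃ r, 0 < r ∧ EquivUpTo f A ⟨Fin r → R⟩},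
      ∃ l : List ℕ, (∀ r ∈ l, 0 < r) ∧ ∃ B C : FinProj R, EquivUpTo f B C ∧
        (l.map fun r : ℕ ↦ toK₀ A.cls - (r : K₀ R)).prod = toK₀ B.cls - toK₀ C.cls by
    obtain ⟨l, hl, B, C, h, hp⟩ := H 1 (by simp [exists_equivUpTo_free hA])
    exact ⟨l, hl, by rw [hp, h.cls_eq, sub_self]⟩
  intro f hf
  induction hf using Submodule.span_induction with
  | mem f hf =>
    obtain ⟨r, hr, h⟩ := hf
    refine ⟨[r], by simpa using hr, A, ⟨Fin r → R⟩, h, ?_⟩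
    rw [cls_free, map_natCast]
    simp
  | zero =>
    refine ⟨[], by simp, ⟨R⟩, ⟨PUnit⟩, ⟨0, 0, by simp, by simp⟩, ?_⟩
    change 1 = toK₀ 1 - toK₀ 0
    simp only [map_one, map_zero, sub_zero]
  | add f g _ _ hf hg =>
    obtain ⟨l, hl, B, C, h, hp⟩ := hf
    obtain ⟨l', hl', B', C', h', hp'⟩ := hg
    refine ⟨l ++ l', fun r hr ↦ (List.mem_append.1 hr).elim (hl r) (hl' r), _, _, h.tensor h', ?_⟩
    rw [List.map_append, List.prod_append, hp, hp', cls_prod ⟨B ⊗[R] B'⟩ ⟨C ⊗[R] C'⟩,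
      cls_prod ⟨B ⊗[R] C'⟩ ⟨C ⊗[R] B'⟩]
    simp only [cls_tensor, map_add, map_mul]
    ring
  | smul a f _ hf =>
    obtain ⟨l, hl, B, C, h, hp⟩ := hf
    exact ⟨l, hl, B, C, h.smul a, hp⟩

/-- A projective module of positive rank has a free multiple. -/
lemma exists_cls_mul_eq_natCast {A : FinProj R}
    (hA : ∀ p, 0 < Module.rankAtStalk (R := R) A p) :
    ∃ (B : FinProj R) (n : ℕ), 0 < n ∧ A.cls * B.cls = n := by
  obtain ⟨l, hl, hl0⟩ := exists_prod_sub_eq_zero hA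
  obtain ⟨_, ⟨y, rfl⟩, n, hn, hy⟩ := exists_mul_eq_natCast (toK₀ (R := R)).rangeS
    (by
      rintro _ ⟨x, rfl⟩
      induction x using Quotient.inductionOn with | _ B
      obtain ⟨N, C, hC⟩ := exists_cls_add_eq_natCast B
      refine ⟨N, fun M hM ↦ ⟨C.cls + (M - N : ℕ), ?_⟩⟩
      rw [eq_sub_iff_add_eq, ← map_natCast toK₀ M, ← Nat.add_sub_cancel' hM, Nat.cast_add, ← hC,
        ← map_add, Nat.add_sub_cancel_left]
      exact congrArg toK₀ (by rw [add_comm, ← add_assoc]; rfl)) _ l (toK₀ A.cls) rfl ⟨_, rfl⟩ hl hl0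
  induction y using Quotient.inductionOn with | _ B
  change _ * toK₀ B.cls = _ at hy
  rw [← map_mul, ← map_natCast toK₀] at hy
  obtain ⟨a, ha⟩ := exists_add_natCast_eq hy
  have hAB : ∀ p, 0 < Module.rankAtStalk (R := R) (A ⊗[R] B) p := by
    intro p
    have := p.nontrivial
    have e := ha
    rw [← cls_tensor, ← cls_free a, ← cls_free n, ← cls_prod, ← cls_prod, cls_eq_cls_iff] at e
    obtain ⟨e⟩ := e
    have := congrFun (Module.rankAtStalk_eq_of_equiv e) p
    simp only [Module.rankAtStalk_prod, Module.rankAtStalk_eq_finrank_of_free, Pi.add_apply,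
      Pi.natCast_apply, Module.finrank_prod, Module.finrank_fin_fun, Nat.cast_id] at this
    omega
  obtain ⟨k, C, hk⟩ := exists_natCast_mul_cls_eq (A := ⟨A ⊗[R] B⟩) hAB
  obtain ⟨j, hj, h⟩ := exists_natCast_mul_eq hn ha hk
  exact ⟨⟨Fin j → B⟩, j * n, mul_pos hj hn, by rw [cls_pi, mul_left_comm, h]⟩

end FinProj

/-- For a finitely generated projective module `P` over a commutative ring `R`, the following are
equivalent: `P` is a generator (separator) of the category of `R`-modules; the rank function of
`P` on `Spec R` is everywhere positive; and there is a finitely generated projective `R`-module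
`Q` with `P ⊗[R] Q ≅ Rⁿ` for some positive `n`. -/
theorem generator_tfae (R : Type u) [CommRing R] (P : Type u) [AddCommGroup P] [Module R P]
    [Module.Finite R P] [Module.Projective R P] :
    List.TFAE
      [ CategoryTheory.IsSeparator (ModuleCat.of R P),
        ∀ p : PrimeSpectrum R, 0 < Module.rankAtStalk P p,
        ∃ (Q : Type u) (_ : AddCommGroup Q) (_ : Module R Q),
          Module.Finite R Q ∧ Module.Projective R Q ∧
            ∃ n : ℕ, 0 < n ∧ Nonempty ((P ⊗[R] Q) ≃ₗ[R] (Fin n → R)) ] := by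
  tfae_have 1 → 2 := by
    intro h p
    rw [Module.rankAtStalk_pos_iff_mem_support]
    by_contra hp
    rw [Module.notMem_support_iff'] at hp
    have := (isSeparator_def _).1 h (𝟙 (ModuleCat.of R p.asIdeal.ResidueField)) 0 fun g ↦ by
      ext x
      obtain ⟨r, hr, hx⟩ := hp x
      have hg : r • g.hom x = 0 := by rw [← map_smul, hx, map_zero]
      rw [Algebra.smul_def, mul_eq_zero, Ideal.algebraMap_residueField_eq_zero] at hg
      simpa using hg.resolve_left hr
    exact one_ne_zero (congr($(this).hom (1 : p.asIdeal.ResidueField)))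
  tfae_have 2 → 1 := by
    intro h
    rw [isSeparator_def]
    intro X Y f g hfg
    ext x
    have h1 : (1 : R) ∈ Ideal.span (Set.range fun y : Module.Dual R P × P ↦ y.1 y.2) := by
      rw [FinProj.span_range_dual_eq_top (A := ⟨P⟩) h]
      trivial
    suffices H : ∀ r ∈ Ideal.span (Set.range fun y : Module.Dual R P × P ↦ y.1 y.2),
        f.hom (r • x) = g.hom (r • x) by
      simpa using H 1 h1
    intro r hr
    induction hr using Submodule.span_induction with
    | mem r hr =>
      obtain ⟨y, rfl⟩ := hr
      exact congr($(hfg (ModuleCat.ofHom (y.1.smulRight x))).hom y.2)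
    | zero => simp
    | add r s _ _ hr hs => rw [add_smul, map_add, map_add, hr, hs]
    | smul a r _ hr => rw [smul_assoc, map_smul f.hom a, map_smul g.hom a, hr]
  tfae_have 2 → 3 := by
    intro h
    obtain ⟨Q, n, hn, e⟩ := FinProj.exists_cls_mul_eq_natCast (A := ⟨P⟩) h
    rw [← FinProj.cls_tensor, ← FinProj.cls_free, FinProj.cls_eq_cls_iff] at e
    exact ⟨Q, inferInstance, inferInstance, inferInstance, inferInstance, n, hn, e⟩
  tfae_have 3 → 2 := by
    rintro ⟨Q, _, _, _, _, n, hn, ⟨e⟩⟩ p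
    have := p.nontrivial
    have h := congrFun (Module.rankAtStalk_eq_of_equiv e) p
    simp only [Module.rankAtStalk_tensorProduct, Module.rankAtStalk_eq_finrank_of_free,
      Pi.mul_apply, Pi.natCast_apply, Module.finrank_fin_fun, Nat.cast_id] at h
    exact Nat.pos_of_mul_pos_right (h ▸ hn)
  tfae_finish
end

section
/- Let R be a commutative ring and let F : Mod(R) ⥤ Mod(R) be an R-linear equivalence from the category of R-modules to itself. Then the R-module F(R) is invertible (there exists an R-module N with F(R) ⊗_R N ≅ R), and F is naturally isomorphic to the functor M ↦ M ⊗_R F(R). -/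
universe u

open TensorProduct CategoryTheory
open MonoidalCategory

/-- For an adjunction `F ⊣ G` between module categories with `G` linear, adjunction followed by
evaluation at `1` identifies `F(R) ⟶ X` with `G(X)`. -/
noncomputable def CategoryTheory.Adjunction.homObjSelfLinearEquiv {R : Type u} [CommRing R]
    {F G : ModuleCat.{u} R ⥤ ModuleCat.{u} R} [G.Additive] [G.Linear R] (adj : F ⊣ G)
    (X : ModuleCat.{u} R) : (F.obj (ModuleCat.of R R) ⟶ X) ≃ₗ[R] G.obj X :=
  LinearEquiv.trans
    { adj.homEquiv (ModuleCat.of R R) X with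
      map_add' := fun f g => by simp [Adjunction.homEquiv_unit, G.map_add]
      map_smul' := fun r f => by simp [Adjunction.homEquiv_unit, G.map_smul] }
    (ModuleCat.homLinearEquiv (S := R) ≪≫ₗ LinearMap.ringLmapEquivSelf R R (G.obj X))

/-- A linear right adjoint `G` of an endofunctor `F` of `R`-modules is the internal hom out of
`F(R)`. -/
noncomputable def CategoryTheory.Adjunction.ihomIsoRightAdjoint {R : Type u} [CommRing R]
    {F G : ModuleCat.{u} R ⥤ ModuleCat.{u} R} [G.Additive] [G.Linear R] (adj : F ⊣ G) :
    ihom (F.obj (ModuleCat.of R R)) ≅ G :=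
  NatIso.ofComponents (fun X => (adj.homObjSelfLinearEquiv X).toModuleIso) fun {X Y} f => by
    ext g
    exact congrArg (fun h : ModuleCat.of R R ⟶ G.obj Y => h.hom (1 : R))
      (adj.homEquiv_naturality_right (X := ModuleCat.of R R) g f)

/-- A left adjoint endofunctor of `R`-modules whose right adjoint is linear is tensoring with its
value at `R`. -/
noncomputable def CategoryTheory.Adjunction.isoTensorRight {R : Type u} [CommRing R]
    {F G : ModuleCat.{u} R ⥤ ModuleCat.{u} R} [G.Additive] [G.Linear R] (adj : F ⊣ G) :
    F ≅ tensorRight (F.obj (ModuleCat.of R R)) :=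
  (adj.ofNatIsoRight adj.ihomIsoRightAdjoint.symm).leftAdjointUniq (ihom.adjunction _) ≪≫
    BraidedCategory.tensorLeftIsoTensorRight _

/-- If `F` is an `R`-linear autoequivalence of the category of `R`-modules, then `F(R)` is an
invertible `R`-module and `F` is naturally isomorphic to the functor `M ↦ M ⊗[R] F(R)`. -/
theorem equivalence_is_tensor (R : Type u) [CommRing R]
    (F : ModuleCat.{u} R ⥤ ModuleCat.{u} R) [F.Additive] [F.Linear R] [F.IsEquivalence] :
    (∃ (N : Type u) (_ : AddCommGroup N) (_ : Module R N),
        Nonempty (((F.obj (ModuleCat.of R R)) ⊗[R] N) ≃ₗ[R] R)) ∧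
      Nonempty (F ≅ tensorRight (F.obj (ModuleCat.of R R))) := by
  let e := F.asEquivalence
  have : e.functor.Additive := ‹F.Additive›
  have : e.functor.Linear R := ‹F.Linear R›
  let α : F ≅ tensorRight (F.obj (ModuleCat.of R R)) := e.toAdjunction.isoTensorRight
  refine ⟨⟨e.inverse.obj (ModuleCat.of R R), inferInstance, inferInstance, ⟨?_⟩⟩, ⟨α⟩⟩
  exact TensorProduct.comm R _ _ ≪≫ₗ
    ((α.app (e.inverse.obj (ModuleCat.of R R))).symm ≪≫
      e.counitIso.app (ModuleCat.of R R)).toLinearEquiv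
end

section
/- There is no commutative ring whose group of units has exactly five elements: for every commutative ring R, the cardinality of R^× is not equal to 5. -/
universe u

open TensorProduct CategoryTheory

/-- In characteristic two, `1 + x + x ^ 4` is a cube root of unity whenever `x ^ 5 = 1`. -/
theorem one_add_add_pow_four_pow_three {R : Type*} [CommRing R] (h2 : (2 : R) = 0) {x : R}
    (hx : x ^ 5 = 1) : (1 + x + x ^ 4) ^ 3 = 1 := by
  have hsq : (1 + x + x ^ 4) ^ 2 = 1 + x ^ 2 + x ^ 3 := by
    linear_combination (x + x ^ 4 + x ^ 5) * h2 + x ^ 3 * hx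
  rw [pow_succ, hsq]
  linear_combination (x + x ^ 2 + x ^ 3 + x ^ 4) * h2 + (x + x ^ 2) * hx

/-- There is no commutative ring with exactly five units. -/
theorem card_units_ne_five (R : Type u) [CommRing R] : Nat.card Rˣ ≠ 5 := by
  intro h
  have hpow (u : Rˣ) : u ^ 5 = 1 := h ▸ pow_card_eq_one'
  have h2 : (2 : R) = 0 := by
    have := congrArg Units.val (hpow (-1))
    push_cast at this
    linear_combination -this
  have : Finite Rˣ := Nat.finite_of_card_ne_zero (by omega)
  have : Nontrivial Rˣ := Finite.one_lt_card_iff_nontrivial.mp (by omega)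
  obtain ⟨u, hu⟩ := exists_ne (1 : Rˣ)
  refine hu ?_
  have hu5 : (u : R) ^ 5 = 1 := by simpa using congrArg Units.val (hpow u)
  have hv3 := one_add_add_pow_four_pow_three h2 hu5
  obtain ⟨v, hv⟩ : IsUnit (1 + (u : R) + (u : R) ^ 4) := .of_pow_eq_one hv3 (by norm_num)
  have hv5 : (v : R) ^ 5 = 1 := by simpa using congrArg Units.val (hpow v)
  rw [← hv] at hv3
  have hv1 : (v : R) = 1 := by linear_combination ((v : R) ^ 3 + 1) * hv3 - (v : R) * hv5
  have hu4 : (u : R) ^ 4 = u := by linear_combination hv1 - hv - (u : R) * h2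
  ext
  rw [Units.val_one]
  linear_combination ((u : R) ^ 2 + 1) * (hu5 - (u : R) * hu4) - hu4
end
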